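/- arXiv:2601.07174 — 4 statements merged into one kernel-verified Lean document; each statement's English description precedes it below -/
import Mathlib

section
/- Discrete summation by parts for the shear stress node coupling: let τ be a discrete function defined at the grid nodes (x_i, y_j), 0 ≤ i ≤ n_x, 0 ≤ j ≤ n_y, let v^x be a discrete function defined at the points (x_i, y_{j+1/2}), 0 ≤ i ≤ n_x, 0 ≤ j ≤ n_y−1, together with boundary values at (x_i, y_0) and (x_i, y_{n_y}), and let v^y be a discrete function defined at the points (x_{i+1/2}, y_j), 0 ≤ i ≤ n_x−1, 0 ≤ j ≤ n_y, together with boundary values at (x_0, y_j) and (x_{n_x}, y_j). Assume v^x vanishes at all boundary points (i = 0, i = n_x, j = 0, j = n_y) and v^y vanishes at all boundary points (j = 0, j = n_y, i = 0, i = n_x). Then (D_x v^y + D_y v^x, τ)_T = −(v^y, d_x τ)_{MT} − (v^x, d_y τ)_{TM}. -/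
open Finset

noncomputable section

/-- The midpoint `x_{i+1/2} = (x_i + x_{i+1})/2`. -/
def midpt (x : ℕ → ℝ) (i : ℕ) : ℝ := (x i + x (i + 1)) / 2

/-- The cell width `h_{i+1/2} = x_{i+1} - x_i`. -/
def hMid (x : ℕ → ℝ) (i : ℕ) : ℝ := x (i + 1) - x i

/-- `h_i = x_{i+1/2} - x_{i-1/2}` for `1 ≤ i ≤ n-1`, together with the boundary
conventions `h_0 = h_{1/2}/2` and `h_n = h_{n-1/2}/2`. -/
def hNode (x : ℕ → ℝ) (n i : ℕ) : ℝ :=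
  if i = 0 then hMid x 0 / 2
  else if i = n then hMid x (n - 1) / 2
  else midpt x i - midpt x (i - 1)

/-- `0 = x_0 < x_1 < ⋯ < x_n = 1`. -/
def IsGrid (x : ℕ → ℝ) (n : ℕ) : Prop :=
  x 0 = 0 ∧ x n = 1 ∧ ∀ i < n, x i < x (i + 1)

/-- Discrete inner product `(φ,θ)_M` over the cell centers `(x_{i+1/2}, y_{j+1/2})`. -/
def ipM (x y : ℕ → ℝ) (nx ny : ℕ) (φ θ : ℕ → ℕ → ℝ) : ℝ :=
  ∑ i ∈ range nx, ∑ j ∈ range ny, hMid x i * hMid y j * φ i j * θ i j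

/-- Discrete inner product `(φ,θ)_T` over the grid nodes `(x_i, y_j)`. -/
def ipT (x y : ℕ → ℝ) (nx ny : ℕ) (φ θ : ℕ → ℕ → ℝ) : ℝ :=
  ∑ i ∈ range (nx + 1), ∑ j ∈ range (ny + 1), hNode x nx i * hNode y ny j * φ i j * θ i j

/-- Discrete inner product `(φ,θ)_{TM}` over the points `(x_i, y_{j+1/2})`,
`1 ≤ i ≤ n_x - 1`, `0 ≤ j ≤ n_y - 1`. -/
def ipTM (x y : ℕ → ℝ) (nx ny : ℕ) (φ θ : ℕ → ℕ → ℝ) : ℝ :=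
  ∑ i ∈ Ico 1 nx, ∑ j ∈ range ny, hNode x nx i * hMid y j * φ i j * θ i j

/-- Discrete inner product `(φ,θ)_{MT}` over the points `(x_{i+1/2}, y_j)`,
`0 ≤ i ≤ n_x - 1`, `1 ≤ j ≤ n_y - 1`. -/
def ipMT (x y : ℕ → ℝ) (nx ny : ℕ) (φ θ : ℕ → ℕ → ℝ) : ℝ :=
  ∑ i ∈ range nx, ∑ j ∈ Ico 1 ny, hMid x i * hNode y ny j * φ i j * θ i j

/-- `D_y` of an edge function `v` given at `(x-index, y_{j+1/2})` with extra boundary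
rows `v0` (at `y_0`) and `vn` (at `y_{n_y}`); the result is a node function. -/
def DyE (y : ℕ → ℝ) (ny : ℕ) (v : ℕ → ℕ → ℝ) (v0 vn : ℕ → ℝ) (i j : ℕ) : ℝ :=
  if j = 0 then (v i 0 - v0 i) / hNode y ny 0
  else if j = ny then (vn i - v i (ny - 1)) / hNode y ny ny
  else (v i j - v i (j - 1)) / hNode y ny j

/-- `D_x` of an edge function `v` given at `(x_{i+1/2}, y-index)` with extra boundary
columns `v0` (at `x_0`) and `vn` (at `x_{n_x}`); the result is a node function. -/
def DxE (x : ℕ → ℝ) (nx : ℕ) (v : ℕ → ℕ → ℝ) (v0 vn : ℕ → ℝ) (i j : ℕ) : ℝ :=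
  if i = 0 then (v 0 j - v0 j) / hNode x nx 0
  else if i = nx then (vn j - v (nx - 1) j) / hNode x nx nx
  else (v i j - v (i - 1) j) / hNode x nx i

lemma IsGrid.hMid_pos {x : ℕ → ℝ} {n i : ℕ} (hx : IsGrid x n) (hi : i < n) :
    0 < hMid x i :=
  sub_pos.2 (hx.2.2 i hi)

lemma IsGrid.hNode_pos {x : ℕ → ℝ} {n i : ℕ} (hx : IsGrid x n) (hn : 0 < n) (hi : i ≤ n) :
    0 < hNode x n i := by
  unfold hNode
  split_ifs with h0 h1
  · exact half_pos (hx.hMid_pos hn)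
  · exact half_pos (hx.hMid_pos (by omega))
  · obtain ⟨k, rfl⟩ := Nat.exists_eq_succ_of_ne_zero h0
    have hl := hx.2.2 k (by omega)
    have hr := hx.2.2 (k + 1) (by omega)
    simp only [midpt, Nat.succ_eq_add_one, Nat.add_sub_cancel]
    linarith

lemma hNode_mul_DxE {x : ℕ → ℝ} {n i j : ℕ} (hx : IsGrid x n) (hn : 0 < n) (hi : i ≤ n)
    (v : ℕ → ℕ → ℝ) {v0 vn : ℕ → ℝ} (h0 : v0 j = 0) (h1 : vn j = 0) :
    hNode x n i * DxE x n v v0 vn i j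
      = (if i < n then v i j else 0) - (if 0 < i then v (i - 1) j else 0) := by
  have hne := (hx.hNode_pos hn hi).ne'
  unfold DxE
  rcases Nat.eq_zero_or_pos i with rfl | hpos
  · rw [if_pos rfl, mul_div_cancel₀ _ hne, if_pos hn, if_neg (lt_irrefl 0), h0]
  · rw [if_neg hpos.ne', if_pos hpos]
    rcases hi.eq_or_lt with rfl | hlt
    · rw [if_pos rfl, mul_div_cancel₀ _ hne, if_neg (lt_irrefl _), h1]
    · rw [if_neg hlt.ne, mul_div_cancel₀ _ hne, if_pos hlt]

lemma sum_hNode_mul_DxE {x : ℕ → ℝ} {n j : ℕ} (hx : IsGrid x n) (hn : 0 < n)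
    (v : ℕ → ℕ → ℝ) {v0 vn : ℕ → ℝ} (h0 : v0 j = 0) (h1 : vn j = 0) (g : ℕ → ℝ) :
    ∑ i ∈ range (n + 1), hNode x n i * DxE x n v v0 vn i j * g i
      = -∑ i ∈ range n, hMid x i * v i j * ((g (i + 1) - g i) / hMid x i) := by
  have hL : ∀ i ∈ range (n + 1), hNode x n i * DxE x n v v0 vn i j * g i
      = (if i < n then v i j else 0) * g i - (if 0 < i then v (i - 1) j else 0) * g i := by
    intro i hi
    rw [hNode_mul_DxE hx hn (Nat.lt_succ_iff.1 (mem_range.1 hi)) v h0 h1, sub_mul]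
  have hR : ∀ i ∈ range n, hMid x i * v i j * ((g (i + 1) - g i) / hMid x i)
      = v i j * g (i + 1) - v i j * g i := by
    intro i hi
    have := (hx.hMid_pos (mem_range.1 hi)).ne'
    field_simp
  rw [sum_congr rfl hL, sum_congr rfl hR, sum_sub_distrib, sum_sub_distrib, neg_sub,
    sum_range_succ, sum_range_succ' (fun i => (if 0 < i then v (i - 1) j else 0) * g i)]
  have hF : ∑ i ∈ range n, (if i < n then v i j else 0) * g i = ∑ i ∈ range n, v i j * g i :=
    sum_congr rfl fun i hi => by rw [if_pos (mem_range.1 hi)]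
  rw [hF]
  simp

lemma sum_range_succ_eq_sum_Ico {n : ℕ} (hn : 0 < n) (f : ℕ → ℝ) (h0 : f 0 = 0) (h1 : f n = 0) :
    ∑ i ∈ range (n + 1), f i = ∑ i ∈ Ico 1 n, f i := by
  rw [sum_range_succ, h1, add_zero, range_eq_Ico, sum_eq_sum_Ico_succ_bot hn, h0, zero_add]

/-- Summation by parts in the first variable, for an edge function vanishing on the boundary. -/
lemma ipT_DxE {x y : ℕ → ℝ} {nx ny : ℕ} (hx : IsGrid x nx) (hnx : 0 < nx) (hny : 0 < ny)
    (v τ : ℕ → ℕ → ℝ) {v0 vn : ℕ → ℝ}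
    (hb : ∀ i < nx, v i 0 = 0) (ht : ∀ i < nx, v i ny = 0)
    (hl : ∀ j ≤ ny, v0 j = 0) (hr : ∀ j ≤ ny, vn j = 0) :
    ipT x y nx ny (DxE x nx v v0 vn) τ
      = -ipMT x y nx ny v (fun i j => (τ (i + 1) j - τ i j) / hMid x i) := by
  have hcol : ∀ j ∈ range (ny + 1),
      ∑ i ∈ range (nx + 1), hNode x nx i * hNode y ny j * DxE x nx v v0 vn i j * τ i j
        = -∑ i ∈ range nx, hMid x i * hNode y ny j * v i j
            * ((τ (i + 1) j - τ i j) / hMid x i) := by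
    intro j hj
    have hj' := Nat.lt_succ_iff.1 (mem_range.1 hj)
    have h := congrArg (hNode y ny j * ·)
      (sum_hNode_mul_DxE hx hnx v (hl j hj') (hr j hj') fun i => τ i j)
    simp only [mul_neg, mul_sum] at h
    rw [← sum_neg_distrib] at h ⊢
    convert h using 2
    · ring
    · ring
  unfold ipT ipMT
  rw [sum_comm, sum_congr rfl hcol, sum_neg_distrib, sum_comm (s := range nx),
    sum_range_succ_eq_sum_Ico hny]
  · exact sum_eq_zero fun i hi => by rw [hb i (mem_range.1 hi)]; ring
  · exact sum_eq_zero fun i hi => by rw [ht i (mem_range.1 hi)]; ring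

lemma ipT_swap (x y : ℕ → ℝ) (nx ny : ℕ) (φ θ : ℕ → ℕ → ℝ) :
    ipT x y nx ny φ θ = ipT y x ny nx (fun j i => φ i j) (fun j i => θ i j) := by
  unfold ipT
  rw [sum_comm]
  simp only [mul_comm (hNode x nx _)]

lemma ipTM_eq_ipMT_swap (x y : ℕ → ℝ) (nx ny : ℕ) (φ θ : ℕ → ℕ → ℝ) :
    ipTM x y nx ny φ θ = ipMT y x ny nx (fun j i => φ i j) (fun j i => θ i j) := by
  unfold ipTM ipMT
  rw [sum_comm]
  simp only [mul_comm (hNode x nx _)]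

lemma ipT_add_left (x y : ℕ → ℝ) (nx ny : ℕ) (φ ψ θ : ℕ → ℕ → ℝ) :
    ipT x y nx ny (fun i j => φ i j + ψ i j) θ
      = ipT x y nx ny φ θ + ipT x y nx ny ψ θ := by
  simp only [ipT, mul_add, add_mul, sum_add_distrib]

/-- Discrete summation by parts for the shear stress node coupling: for a node
function `τ` (with `τ i j` the value at `(x_i, y_j)`), an edge function `vx`
(with `vx i j` the value at `(x_i, y_{j+1/2})`, and extra boundary rows `vx0, vxn`
at `(x_i, y_0)` and `(x_i, y_{n_y})`), and an edge function `vy` (with `vy i j` the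
value at `(x_{i+1/2}, y_j)`, and extra boundary columns `vy0, vyn` at `(x_0, y_j)`
and `(x_{n_x}, y_j)`), all boundary values of `vx` and `vy` vanishing, one has
`(D_x v^y + D_y v^x, τ)_T = -(v^y, d_x τ)_{MT} - (v^x, d_y τ)_{TM}`. -/
theorem mac_summation_by_parts_shear
    (nx ny : ℕ) (hnx : 2 ≤ nx) (hny : 2 ≤ ny)
    (x y : ℕ → ℝ) (hx : IsGrid x nx) (hy : IsGrid y ny)
    (τ : ℕ → ℕ → ℝ)
    (vx : ℕ → ℕ → ℝ) (vx0 vxn : ℕ → ℝ)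
    (vy : ℕ → ℕ → ℝ) (vy0 vyn : ℕ → ℝ)
    (hvxl : ∀ j < ny, vx 0 j = 0) (hvxr : ∀ j < ny, vx nx j = 0)
    (hvxb : ∀ i ≤ nx, vx0 i = 0) (hvxt : ∀ i ≤ nx, vxn i = 0)
    (hvyb : ∀ i < nx, vy i 0 = 0) (hvyt : ∀ i < nx, vy i ny = 0)
    (hvyl : ∀ j ≤ ny, vy0 j = 0) (hvyr : ∀ j ≤ ny, vyn j = 0) :
    ipT x y nx ny
        (fun i j => DxE x nx vy vy0 vyn i j + DyE y ny vx vx0 vxn i j) τ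
      = - ipMT x y nx ny vy (fun i j => (τ (i + 1) j - τ i j) / hMid x i)
        - ipTM x y nx ny vx (fun i j => (τ i (j + 1) - τ i j) / hMid y j) := by
  rw [ipT_add_left, ipT_DxE hx (by omega) (by omega) vy τ hvyb hvyt hvyl hvyr,
    ipT_swap x y nx ny (DyE y ny vx vx0 vxn), ipTM_eq_ipMT_swap, sub_eq_add_neg]
  exact congrArg _ (ipT_DxE hy (by omega) (by omega) (fun j i => vx i j) (fun j i => τ i j)
    hvxl hvxr hvxb hvxt)
end
end

section
/- Improved bound for the discrete integration operator on a uniform mesh: assume the uniform partitions x_i = i/n_x and y_j = j/n_y. Let v be a discrete function defined at the points (x_i, y_{j+1/2}), 1 ≤ i ≤ n_x−1, 0 ≤ j ≤ n_y−1, and define τ at the cell centers by τ_{i+1/2,j+1/2} = Σ_{k=1}^{i} h_k v_{k,j+1/2} (with empty sum for i = 0). Then ‖τ‖_M² ≤ (1/2)‖v‖_{TM}². -/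
open Finset

noncomputable section

theorem hMid_uniform {n : ℕ} {x : ℕ → ℝ} (hx : ∀ i, x i = (i : ℝ) / n) (i : ℕ) :
    hMid x i = 1 / n := by
  rw [hMid, hx, hx]
  push_cast
  ring

theorem hNode_uniform {n : ℕ} {x : ℕ → ℝ} (hx : ∀ i, x i = (i : ℝ) / n) {i : ℕ}
    (hi : 1 ≤ i) (hin : i < n) : hNode x n i = 1 / n := by
  obtain ⟨k, rfl⟩ : ∃ k, i = k + 1 := ⟨i - 1, by omega⟩
  rw [hNode, if_neg (by omega), if_neg (by omega), midpt, midpt, Nat.add_sub_cancel]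
  simp only [hx]
  push_cast
  ring

/-- Discrete Hardy-type bound: Cauchy–Schwarz on every partial sum, then summation of the
resulting factors `i` over `i < n`. -/
theorem sum_range_sq_partial_sum_le (n : ℕ) (w : ℕ → ℝ) :
    ∑ i ∈ range n, (∑ k ∈ Icc 1 i, w k) ^ 2 ≤ (n : ℝ) ^ 2 / 2 * ∑ k ∈ Ico 1 n, w k ^ 2 := by
  have hS : 0 ≤ ∑ k ∈ Ico 1 n, w k ^ 2 := sum_nonneg fun k _ => sq_nonneg _
  have hrow : ∀ i ∈ range n,
      (∑ k ∈ Icc 1 i, w k) ^ 2 ≤ (i : ℝ) * ∑ k ∈ Ico 1 n, w k ^ 2 := by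
    intro i hi
    have hcs := sq_sum_le_card_mul_sum_sq (s := Icc 1 i) (f := w)
    rw [Nat.card_Icc, Nat.add_sub_cancel] at hcs
    refine hcs.trans (mul_le_mul_of_nonneg_left ?_ (Nat.cast_nonneg i))
    refine sum_le_sum_of_subset_of_nonneg (fun k hk => ?_) fun k _ _ => sq_nonneg _
    simp only [mem_Icc, mem_Ico, mem_range] at *
    omega
  have hgauss : ∑ i ∈ range n, (i : ℝ) ≤ (n : ℝ) ^ 2 / 2 := by
    clear hrow hS
    induction n with
    | zero => simp
    | succ m ih =>
      rw [sum_range_succ]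
      push_cast
      linarith
  calc _ ≤ ∑ i ∈ range n, (i : ℝ) * ∑ k ∈ Ico 1 n, w k ^ 2 := sum_le_sum hrow
    _ = (∑ i ∈ range n, (i : ℝ)) * ∑ k ∈ Ico 1 n, w k ^ 2 := by rw [sum_mul]
    _ ≤ _ := mul_le_mul_of_nonneg_right hgauss hS

/-- Improved bound for the discrete integration operator on a uniform mesh:
with the uniform partitions `x_i = i/n_x`, `y_j = j/n_y`, and
`τ_{i+1/2,j+1/2} = ∑_{k=1}^{i} h_k v_{k,j+1/2}`, one has `‖τ‖_M² ≤ (1/2)‖v‖_{TM}²`. -/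
theorem mac_discrete_integration_operator_uniform
    (nx ny : ℕ) (hnx : 2 ≤ nx) (hny : 2 ≤ ny)
    (x y : ℕ → ℝ)
    (hx : ∀ i, x i = (i : ℝ) / nx) (hy : ∀ j, y j = (j : ℝ) / ny)
    (v τ : ℕ → ℕ → ℝ)
    (hτ : ∀ i j, τ i j = ∑ k ∈ Icc 1 i, hNode x nx k * v k j) :
    ipM x y nx ny τ τ ≤ (1 / 2) * ipTM x y nx ny v v := by
  have hn : (0 : ℝ) < nx := by exact_mod_cast (by omega : 0 < nx)
  rw [ipM, ipTM, sum_comm, sum_comm (s := Ico 1 nx), mul_sum]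
  refine sum_le_sum fun j _ => ?_
  have hτ_sum : ∀ i ∈ range nx, hMid x i * hMid y j * τ i j * τ i j =
      1 / nx ^ 3 * (1 / ny) * (∑ k ∈ Icc 1 i, v k j) ^ 2 := by
    intro i hi
    have hnode : τ i j = 1 / nx * ∑ k ∈ Icc 1 i, v k j := by
      rw [hτ, mul_sum]
      refine sum_congr rfl fun k hk => ?_
      rw [mem_Icc] at hk
      rw [hNode_uniform hx hk.1 (hk.2.trans_lt (mem_range.mp hi))]
    rw [hnode, hMid_uniform hx, hMid_uniform hy]
    ring
  have hv_sum : ∀ k ∈ Ico 1 nx, hNode x nx k * hMid y j * v k j * v k j =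
      1 / nx * (1 / ny) * v k j ^ 2 := by
    intro k hk
    rw [mem_Ico] at hk
    rw [hNode_uniform hx hk.1 hk.2, hMid_uniform hy]
    ring
  rw [sum_congr rfl hτ_sum, sum_congr rfl hv_sum, ← mul_sum, ← mul_sum]
  calc _ ≤ 1 / (nx : ℝ) ^ 3 * (1 / ny) * ((nx : ℝ) ^ 2 / 2 * ∑ k ∈ Ico 1 nx, v k j ^ 2) :=
        mul_le_mul_of_nonneg_left (sum_range_sq_partial_sum_le nx fun k => v k j) (by positivity)
    _ = _ := by
        field_simp
end
end

section
/- Coercivity of the discrete elasticity bilinear form: for all λ, μ > 0 and all discrete tensors Z = (Z^{11}, Z^{22}, Z^{12}), a_h(λ; Z, Z) ≥ (1/μ)‖Z^{12}‖_T² + (1/(2λ+2μ))(‖Z^{11}‖_M² + ‖Z^{22}‖_M²). -/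
open Finset

noncomputable section

/-- The discrete elasticity bilinear form `a_h(λ; Z, τ)`. -/
def aForm (x y : ℕ → ℝ) (nx ny : ℕ) (lam mu : ℝ)
    (Z11 Z22 Z12 t11 t22 t12 : ℕ → ℕ → ℝ) : ℝ :=
  (1 / mu) * ipT x y nx ny Z12 t12
    - (1 / (2 * mu)) * (lam / (2 * lam + 2 * mu)) *
        (ipM x y nx ny Z11 t22 + ipM x y nx ny Z22 t11)
    + (1 / (2 * mu)) * (1 - lam / (2 * lam + 2 * mu)) *
        (ipM x y nx ny Z11 t11 + ipM x y nx ny Z22 t22)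

/-- Additivity of `ipM` in both arguments gives the usual expansion of `‖φ - θ‖_M²`. -/
lemma ipM_sub_self (x y : ℕ → ℝ) (nx ny : ℕ) (φ θ : ℕ → ℕ → ℝ) :
    ipM x y nx ny (φ - θ) (φ - θ) =
      ipM x y nx ny φ φ + ipM x y nx ny θ θ - (ipM x y nx ny φ θ + ipM x y nx ny θ φ) := by
  simp only [ipM, ← Finset.sum_add_distrib, ← Finset.sum_sub_distrib, Pi.sub_apply]
  refine Finset.sum_congr rfl fun i _ => Finset.sum_congr rfl fun j _ => ?_
  ring

lemma IsGrid.hMid_nonneg {x : ℕ → ℝ} {n i : ℕ} (hx : IsGrid x n) (hi : i < n) :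
    0 ≤ hMid x i :=
  sub_nonneg.2 (hx.2.2 i hi).le

lemma ipM_self_nonneg {x y : ℕ → ℝ} {nx ny : ℕ} (hx : IsGrid x nx) (hy : IsGrid y ny)
    (φ : ℕ → ℕ → ℝ) : 0 ≤ ipM x y nx ny φ φ := by
  refine Finset.sum_nonneg fun i hi => Finset.sum_nonneg fun j hj => ?_
  rw [mul_assoc]
  exact mul_nonneg (mul_nonneg (hx.hMid_nonneg (Finset.mem_range.1 hi))
    (hy.hMid_nonneg (Finset.mem_range.1 hj))) (mul_self_nonneg _)

/-- Coercivity of the discrete elasticity bilinear form: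
`a_h(λ; Z, Z) ≥ (1/μ)‖Z¹²‖_T² + (1/(2λ+2μ))(‖Z¹¹‖_M² + ‖Z²²‖_M²)`. -/
theorem mac_aForm_coercive
    (nx ny : ℕ) (hnx : 2 ≤ nx) (hny : 2 ≤ ny)
    (x y : ℕ → ℝ) (hx : IsGrid x nx) (hy : IsGrid y ny)
    (lam mu : ℝ) (hlam : 0 < lam) (hmu : 0 < mu)
    (Z11 Z22 Z12 : ℕ → ℕ → ℝ) :
    aForm x y nx ny lam mu Z11 Z22 Z12 Z11 Z22 Z12
      ≥ (1 / mu) * ipT x y nx ny Z12 Z12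
        + (1 / (2 * lam + 2 * mu)) * (ipM x y nx ny Z11 Z11 + ipM x y nx ny Z22 Z22) := by
  have hcoef : (1 / (2 * mu)) * (1 - lam / (2 * lam + 2 * mu)) =
      (1 / (2 * mu)) * (lam / (2 * lam + 2 * mu)) + 1 / (2 * lam + 2 * mu) := by
    field_simp
    ring
  have hnonneg : 0 ≤ (1 / (2 * mu)) * (lam / (2 * lam + 2 * mu)) *
      ipM x y nx ny (Z11 - Z22) (Z11 - Z22) :=
    mul_nonneg (by positivity) (ipM_self_nonneg hx hy _)
  rw [ipM_sub_self] at hnonneg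
  rw [aForm, hcoef]
  linarith
end
end

section
/- Second-order truncation estimate at the cell centers for the corrected displacement interpolant: let u ∈ C³([0,1]²) and define ũ at the points (x_i, y_{j+1/2}) by ũ_{i,j+1/2} = u(x_i, y_{j+1/2}) − (l_{j+1/2}²/8)∂²_yu(x_i, y_{j+1/2}). Then there is a constant C, independent of the partitions and of u, such that |∂_xu(x_{i+1/2}, y_{j+1/2}) − [d_xũ]_{i+1/2,j+1/2}| ≤ C(h²+l²)‖u‖_{3,∞} for all 0 ≤ i ≤ n_x−1, 0 ≤ j ≤ n_y−1, where [d_xũ]_{i+1/2,j+1/2} = (ũ_{i+1,j+1/2} − ũ_{i,j+1/2})/h_{i+1/2}. -/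
open Finset

noncomputable section

/-- First partial derivative in `x`. -/
def pdx (f : ℝ × ℝ → ℝ) (p : ℝ × ℝ) : ℝ := deriv (fun t => f (t, p.2)) p.1

/-- First partial derivative in `y`. -/
def pdy (f : ℝ × ℝ → ℝ) (p : ℝ × ℝ) : ℝ := deriv (fun t => f (p.1, t)) p.2

/-- The norm `‖f‖_{3,∞}`: the sup over `[0,1]²` of the derivatives of `f` of order at
most `3`. -/
def norm3 (f : ℝ × ℝ → ℝ) : ℝ :=
  ⨆ p : Set.Icc ((0 : ℝ), (0 : ℝ)) ((1 : ℝ), (1 : ℝ)), ⨆ k : Fin 4,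
    ‖iteratedFDeriv ℝ (k : ℕ) f (p : ℝ × ℝ)‖

/-- The mesh size `h = max_i h_{i+1/2}`. -/
def hmax (x : ℕ → ℝ) (n : ℕ) : ℝ := ⨆ i : Fin n, hMid x i

theorem pdx_eq_fderiv {f : ℝ × ℝ → ℝ} (hf : Differentiable ℝ f) :
    pdx f = fun p => fderiv ℝ f p (1, 0) := by
  ext p
  exact ((hf p).hasFDerivAt.comp_hasDerivAt p.1
    ((hasDerivAt_id p.1).prodMk (hasDerivAt_const p.1 p.2))).deriv

theorem pdy_eq_fderiv {f : ℝ × ℝ → ℝ} (hf : Differentiable ℝ f) :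
    pdy f = fun p => fderiv ℝ f p (0, 1) := by
  ext p
  exact ((hf p).hasFDerivAt.comp_hasDerivAt p.2
    ((hasDerivAt_const p.2 p.1).prodMk (hasDerivAt_id p.2))).deriv

theorem hasDerivAt_pdx {f : ℝ × ℝ → ℝ} (hf : Differentiable ℝ f) (t c : ℝ) :
    HasDerivAt (fun t => f (t, c)) (pdx f (t, c)) t :=
  DifferentiableAt.hasDerivAt (f := fun t => f (t, c)) (by fun_prop)

theorem contDiff_fderiv_apply {n : ℕ} {f : ℝ × ℝ → ℝ} (hf : ContDiff ℝ (n + 1 : ℕ) f)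
    (v : ℝ × ℝ) : ContDiff ℝ n fun p => fderiv ℝ f p v :=
  (hf.fderiv_right (by norm_cast)).clm_apply contDiff_const

theorem norm_iteratedFDeriv_fderiv_apply_le {n : ℕ} {f : ℝ × ℝ → ℝ}
    (hf : ContDiff ℝ (n + 1 : ℕ) f) {v : ℝ × ℝ} (hv : ‖v‖ ≤ 1) (p : ℝ × ℝ) :
    ‖iteratedFDeriv ℝ n (fun q => fderiv ℝ f q v) p‖ ≤ ‖iteratedFDeriv ℝ (n + 1) f p‖ := by
  have hd : ContDiff ℝ n (fderiv ℝ f) := hf.fderiv_right (by norm_cast)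
  refine (norm_iteratedFDeriv_clm_apply_const hd.contDiffAt le_rfl).trans ?_
  rw [norm_iteratedFDeriv_fderiv]
  exact mul_le_of_le_one_left (norm_nonneg _) hv

theorem contDiff_pdx {n : ℕ} {f : ℝ × ℝ → ℝ} (hf : ContDiff ℝ (n + 1 : ℕ) f) :
    ContDiff ℝ n (pdx f) := by
  rw [pdx_eq_fderiv (hf.differentiable (by simp))]
  exact contDiff_fderiv_apply hf _

theorem contDiff_pdy {n : ℕ} {f : ℝ × ℝ → ℝ} (hf : ContDiff ℝ (n + 1 : ℕ) f) :
    ContDiff ℝ n (pdy f) := by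
  rw [pdy_eq_fderiv (hf.differentiable (by simp))]
  exact contDiff_fderiv_apply hf _

theorem norm_iteratedFDeriv_pdx_le {n : ℕ} {f : ℝ × ℝ → ℝ} (hf : ContDiff ℝ (n + 1 : ℕ) f)
    (p : ℝ × ℝ) : ‖iteratedFDeriv ℝ n (pdx f) p‖ ≤ ‖iteratedFDeriv ℝ (n + 1) f p‖ := by
  rw [pdx_eq_fderiv (hf.differentiable (by simp))]
  exact norm_iteratedFDeriv_fderiv_apply_le hf (by simp [Prod.norm_def]) p

theorem norm_iteratedFDeriv_pdy_le {n : ℕ} {f : ℝ × ℝ → ℝ} (hf : ContDiff ℝ (n + 1 : ℕ) f)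
    (p : ℝ × ℝ) : ‖iteratedFDeriv ℝ n (pdy f) p‖ ≤ ‖iteratedFDeriv ℝ (n + 1) f p‖ := by
  rw [pdy_eq_fderiv (hf.differentiable (by simp))]
  exact norm_iteratedFDeriv_fderiv_apply_le hf (by simp [Prod.norm_def]) p

theorem abs_pdx_pdx_pdx_le {u : ℝ × ℝ → ℝ} (hu : ContDiff ℝ 3 u) (p : ℝ × ℝ) :
    |pdx (pdx (pdx u)) p| ≤ ‖iteratedFDeriv ℝ 3 u p‖ := by
  have h1 : ContDiff ℝ 2 (pdx u) := contDiff_pdx (n := 2) hu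
  have h2 : ContDiff ℝ 1 (pdx (pdx u)) := contDiff_pdx (n := 1) h1
  rw [← Real.norm_eq_abs, ← norm_iteratedFDeriv_zero (𝕜 := ℝ)]
  exact (norm_iteratedFDeriv_pdx_le (n := 0) h2 p).trans <|
    (norm_iteratedFDeriv_pdx_le (n := 1) h1 p).trans (norm_iteratedFDeriv_pdx_le (n := 2) hu p)

theorem abs_pdx_pdy_pdy_le {u : ℝ × ℝ → ℝ} (hu : ContDiff ℝ 3 u) (p : ℝ × ℝ) :
    |pdx (pdy (pdy u)) p| ≤ ‖iteratedFDeriv ℝ 3 u p‖ := by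
  have h1 : ContDiff ℝ 2 (pdy u) := contDiff_pdy (n := 2) hu
  have h2 : ContDiff ℝ 1 (pdy (pdy u)) := contDiff_pdy (n := 1) h1
  rw [← Real.norm_eq_abs, ← norm_iteratedFDeriv_zero (𝕜 := ℝ)]
  exact (norm_iteratedFDeriv_pdx_le (n := 0) h2 p).trans <|
    (norm_iteratedFDeriv_pdy_le (n := 1) h1 p).trans (norm_iteratedFDeriv_pdy_le (n := 2) hu p)

theorem norm_iteratedFDeriv_le_norm3 {u : ℝ × ℝ → ℝ} (hu : ContDiff ℝ 3 u) {p : ℝ × ℝ}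
    (hp : p ∈ Set.Icc ((0 : ℝ), (0 : ℝ)) ((1 : ℝ), (1 : ℝ))) (k : Fin 4) :
    ‖iteratedFDeriv ℝ (k : ℕ) u p‖ ≤ norm3 u := by
  have hc : Continuous fun q => ∑ k : Fin 4, ‖iteratedFDeriv ℝ (k : ℕ) u q‖ :=
    continuous_finsetSum _ fun k _ =>
      (hu.continuous_iteratedFDeriv (by exact_mod_cast Nat.lt_succ_iff.mp k.2)).norm
  obtain ⟨M, hM⟩ := ((isCompact_Icc (a := ((0 : ℝ), (0 : ℝ))) (b := (1, 1))).image hc).bddAbove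
  have hb : BddAbove (Set.range fun q : Set.Icc ((0 : ℝ), (0 : ℝ)) ((1 : ℝ), (1 : ℝ)) =>
      ⨆ k : Fin 4, ‖iteratedFDeriv ℝ (k : ℕ) u (q : ℝ × ℝ)‖) := by
    refine ⟨M, ?_⟩
    rintro _ ⟨q, rfl⟩
    refine (ciSup_le fun k => ?_).trans (hM ⟨q, q.2, rfl⟩)
    exact Finset.single_le_sum (f := fun k : Fin 4 => ‖iteratedFDeriv ℝ (k : ℕ) u (q : ℝ × ℝ)‖)
      (fun _ _ => norm_nonneg _) (Finset.mem_univ k)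
  exact (le_ciSup (f := fun k : Fin 4 => ‖iteratedFDeriv ℝ (k : ℕ) u p‖)
    (Set.finite_range _).bddAbove k).trans (le_ciSup hb ⟨p, hp⟩)

theorem hMid_le_hmax (x : ℕ → ℝ) {n i : ℕ} (hi : i < n) : hMid x i ≤ hmax x n :=
  le_ciSup (f := fun i : Fin n => hMid x i) (Set.finite_range _).bddAbove ⟨i, hi⟩

theorem IsGrid.mono {x : ℕ → ℝ} {n : ℕ} (hx : IsGrid x n) {a b : ℕ} (hab : a ≤ b)
    (hb : b ≤ n) : x a ≤ x b := by
  induction b, hab using Nat.le_induction with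
  | base => rfl
  | succ b _ ih => exact (ih (by omega)).trans (hx.2.2 b (by omega)).le

theorem IsGrid.mem_Icc {x : ℕ → ℝ} {n i : ℕ} (hx : IsGrid x n) (hi : i ≤ n) :
    x i ∈ Set.Icc (0 : ℝ) 1 :=
  ⟨hx.1 ▸ hx.mono (Nat.zero_le i) hi, hx.2.1 ▸ hx.mono hi le_rfl⟩

/-- Central differences approximate the first derivative to second order. -/
theorem abs_central_difference_le {g g₁ g₂ g₃ : ℝ → ℝ} (h₀ : ∀ t, HasDerivAt g (g₁ t) t)
    (h₁ : ∀ t, HasDerivAt g₁ (g₂ t) t) (h₂ : ∀ t, HasDerivAt g₂ (g₃ t) t) {m δ K : ℝ}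
    (hδ : 0 ≤ δ) (hK : ∀ t ∈ Set.Icc (m - δ) (m + δ), |g₃ t| ≤ K) :
    |g (m + δ) - g (m - δ) - 2 * δ * g₁ m| ≤ 2 * K * δ ^ 3 := by
  have hK0 : 0 ≤ K := (abs_nonneg _).trans (hK m ⟨by linarith, by linarith⟩)
  have b₂ (s : ℝ) (hs : s ∈ Set.Icc 0 δ) : |g₂ (m + s) - g₂ (m - s)| ≤ 2 * K * δ := by
    have h := (convex_Icc (m - δ) (m + δ)).norm_image_sub_le_of_norm_hasDerivWithin_le
      (fun t _ => (h₂ t).hasDerivWithinAt) hK (x := m - s) (y := m + s)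
      ⟨by linarith [hs.2], by linarith [hs.1]⟩ ⟨by linarith [hs.1], by linarith [hs.2]⟩
    rw [Real.norm_eq_abs, Real.norm_eq_abs, show m + s - (m - s) = 2 * s by ring,
      abs_of_nonneg (a := 2 * s) (by linarith [hs.1])] at h
    nlinarith [hs.2]
  have hadd (s : ℝ) : HasDerivAt (fun s => m + s) 1 s := (hasDerivAt_id s).const_add m
  have hsub (s : ℝ) : HasDerivAt (fun s => m - s) (-1) s := (hasDerivAt_id s).const_sub m
  have b₁ (s : ℝ) (hs : s ∈ Set.Icc 0 δ) :
      |g₁ (m + s) + g₁ (m - s) - 2 * g₁ m| ≤ 2 * K * δ * δ := by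
    have hd (s : ℝ) : HasDerivAt (fun s => g₁ (m + s) + g₁ (m - s))
        (g₂ (m + s) - g₂ (m - s)) s :=
      (((h₁ _).comp s (hadd s)).add ((h₁ _).comp s (hsub s))).congr_deriv (by ring)
    have h := (convex_Icc 0 δ).norm_image_sub_le_of_norm_hasDerivWithin_le
      (fun t _ => (hd t).hasDerivWithinAt) b₂ (x := 0) ⟨le_rfl, hδ⟩ hs
    simp only [Real.norm_eq_abs, add_zero, sub_zero, abs_of_nonneg hs.1] at h
    rw [two_mul (g₁ m)]
    exact h.trans (mul_le_mul_of_nonneg_left hs.2 (by positivity))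
  have hd (s : ℝ) : HasDerivAt (fun s => g (m + s) - g (m - s) - 2 * s * g₁ m)
      (g₁ (m + s) + g₁ (m - s) - 2 * g₁ m) s :=
    ((((h₀ _).comp s (hadd s)).sub ((h₀ _).comp s (hsub s))).sub
      (((hasDerivAt_id s).const_mul 2).mul_const (g₁ m))).congr_deriv (by ring)
  have h := (convex_Icc 0 δ).norm_image_sub_le_of_norm_hasDerivWithin_le
    (fun t _ => (hd t).hasDerivWithinAt) b₁ (x := 0) (y := δ) ⟨le_rfl, hδ⟩ ⟨hδ, le_rfl⟩
  simp only [Real.norm_eq_abs, add_zero, sub_zero, sub_self, mul_zero, zero_mul,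
    abs_of_nonneg hδ] at h
  exact h.trans_eq (by ring)

/-- Second-order truncation estimate at the cell centers for the corrected displacement
interpolant `ũ_{i,j+1/2} = u(x_i, y_{j+1/2}) - (l_{j+1/2}²/8)∂²_y u(x_i, y_{j+1/2})`:
`|∂ₓu(x_{i+1/2}, y_{j+1/2}) - [d_x ũ]_{i+1/2,j+1/2}| ≤ C(h²+l²)‖u‖_{3,∞}` for all
`0 ≤ i ≤ n_x - 1`, `0 ≤ j ≤ n_y - 1`. -/
theorem mac_displacement_interpolant_truncation_centers :
    ∃ C > (0 : ℝ), ∀ (nx ny : ℕ), 2 ≤ nx → 2 ≤ ny → ∀ (x y : ℕ → ℝ),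
      IsGrid x nx → IsGrid y ny → ∀ u : ℝ × ℝ → ℝ, ContDiff ℝ 3 u →
      ∀ i < nx, ∀ j < ny,
        |pdx u (midpt x i, midpt y j)
            - ((u (x (i + 1), midpt y j)
                  - (hMid y j) ^ 2 / 8 * pdy (pdy u) (x (i + 1), midpt y j))
               - (u (x i, midpt y j)
                  - (hMid y j) ^ 2 / 8 * pdy (pdy u) (x i, midpt y j))) / hMid x i|
          ≤ C * ((hmax x nx) ^ 2 + (hmax y ny) ^ 2) * norm3 u := by
  refine ⟨1, one_pos, fun nx ny _ _ x y hx hy u hu i hi j hj => ?_⟩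
  have hxi := hx.mem_Icc hi.le
  have hxi' := hx.mem_Icc (Nat.succ_le_of_lt hi)
  have hyj := hy.mem_Icc hj.le
  have hyj' := hy.mem_Icc (Nat.succ_le_of_lt hj)
  have hc : midpt y j ∈ Set.Icc (0 : ℝ) 1 := by
    unfold midpt
    constructor <;> linarith [hyj.1, hyj'.1, hyj.2, hyj'.2]
  have hh : 0 < hMid x i := sub_pos.mpr (hx.2.2 i hi)
  have hl : 0 < hMid y j := sub_pos.mpr (hy.2.2 j hj)
  have hh' := hMid_le_hmax x hi
  have hl' := hMid_le_hmax y hj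
  have hb (t : ℝ) (ht : t ∈ Set.Icc (x i) (x (i + 1))) :
      ‖iteratedFDeriv ℝ 3 u (t, midpt y j)‖ ≤ norm3 u :=
    norm_iteratedFDeriv_le_norm3 hu
      ⟨⟨hxi.1.trans ht.1, hc.1⟩, ⟨ht.2.trans hxi'.2, hc.2⟩⟩ 3
  have hN : 0 ≤ norm3 u := (norm_nonneg _).trans (hb (x i) ⟨le_rfl, (hx.2.2 i hi).le⟩)
  have hux : ContDiff ℝ 2 (pdx u) := contDiff_pdx (n := 2) hu
  have huxx : ContDiff ℝ 1 (pdx (pdx u)) := contDiff_pdx (n := 1) hux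
  have huy : ContDiff ℝ 2 (pdy u) := contDiff_pdy (n := 2) hu
  have huyy : ContDiff ℝ 1 (pdy (pdy u)) := contDiff_pdy (n := 1) huy
  have ha : midpt x i - hMid x i / 2 = x i := by unfold midpt hMid; ring
  have ha' : midpt x i + hMid x i / 2 = x (i + 1) := by unfold midpt hMid; ring
  have e₁ := abs_central_difference_le (m := midpt x i) (δ := hMid x i / 2) (K := norm3 u)
    (fun t => hasDerivAt_pdx (hu.differentiable (by simp)) t (midpt y j))
    (fun t => hasDerivAt_pdx (hux.differentiable (by simp)) t (midpt y j))
    (fun t => hasDerivAt_pdx (huxx.differentiable (by simp)) t (midpt y j)) (by positivity)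
    (fun t ht => (abs_pdx_pdx_pdx_le hu _).trans (hb t (by rwa [ha, ha'] at ht)))
  have e₂ := (convex_Icc (x i) (x (i + 1))).norm_image_sub_le_of_norm_hasDerivWithin_le
    (fun t _ => (hasDerivAt_pdx (huyy.differentiable (by simp)) t (midpt y j)).hasDerivWithinAt)
    (fun t ht => (abs_pdx_pdy_pdy_le hu _).trans (hb t ht))
    ⟨le_rfl, (hx.2.2 i hi).le⟩ ⟨(hx.2.2 i hi).le, le_rfl⟩
  change _ ≤ norm3 u * |hMid x i| at e₂
  rw [ha, ha'] at e₁
  rw [Real.norm_eq_abs, abs_of_pos hh] at e₂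
  generalize pdx u (midpt x i, midpt y j) = d at *
  generalize u (x (i + 1), midpt y j) = b at *
  generalize u (x i, midpt y j) = a at *
  generalize pdy (pdy u) (x (i + 1), midpt y j) = b₂ at *
  generalize pdy (pdy u) (x i, midpt y j) = a₂ at *
  generalize hMid x i = h at *
  generalize hMid y j = l at *
  have key : d - ((b - l ^ 2 / 8 * b₂) - (a - l ^ 2 / 8 * a₂)) / h
      = (-(b - a - 2 * (h / 2) * d) + l ^ 2 / 8 * (b₂ - a₂)) / h := by
    field_simp
    ring
  rw [key, abs_div, abs_of_pos hh, div_le_iff₀ hh]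
  calc |-(b - a - 2 * (h / 2) * d) + l ^ 2 / 8 * (b₂ - a₂)|
      ≤ |b - a - 2 * (h / 2) * d| + l ^ 2 / 8 * |b₂ - a₂| := by
        refine (abs_add_le _ _).trans_eq ?_
        rw [abs_neg, abs_mul, abs_of_nonneg (by positivity : 0 ≤ l ^ 2 / 8)]
    _ ≤ 2 * norm3 u * (h / 2) ^ 3 + l ^ 2 / 8 * (norm3 u * h) := by gcongr
    _ = (h ^ 2 / 4 + l ^ 2 / 8) * norm3 u * h := by ring
    _ ≤ 1 * (hmax x nx ^ 2 + hmax y ny ^ 2) * norm3 u * h := by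
        have := pow_le_pow_left₀ hh.le hh' 2
        have := pow_le_pow_left₀ hl.le hl' 2
        gcongr
        nlinarith [sq_nonneg h, sq_nonneg l]
end
end
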